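/- For every even integer n ≥ 4, b_n ≥ 32·m_n⁴/s_n⁴, i.e., b_n·s_n⁴ ≥ 32·m_n⁴, where b_n is the number of bent functions in n variables, m_n = |M_n|, and s_n is the number of distinct vertical signatures realized by elements of M_n. -/

import Mathlib

/-- `𝔽₂ⁿ`, the space of binary vectors of length `n`. -/
abbrev BV (n : ℕ) : Type := Fin n → ZMod 2

/-- The inner product `⟨x, y⟩ = ⊕ᵢ xᵢ yᵢ` on `𝔽₂ⁿ`. -/
def ip {n : ℕ} (x y : BV n) : ZMod 2 := ∑ i, x i * y i

/-- The Walsh transform `W_f(y) = ∑_{x} (−1)^{f(x) ⊕ ⟨x,y⟩}` of a Boolean function. -/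
def walsh {n : ℕ} (f : BV n → ZMod 2) (y : BV n) : ℤ :=
  ∑ x : BV n, (-1 : ℤ) ^ ((f x + ip x y).val)

/-- A Boolean function in `n` variables (`n` even) is bent if `|W_f(y)| = 2^{n/2}`
for all `y`. -/
def IsBent (n : ℕ) (f : BV n → ZMod 2) : Prop :=
  ∀ y : BV n, |walsh f y| = 2 ^ (n / 2)

/-- `b_n`, the number of bent functions in `n` variables. -/
noncomputable def bentCount (n : ℕ) : ℕ :=
  Nat.card {f : BV n → ZMod 2 // IsBent n f}

/-- Membership in `M_n` (with `m = n/2 - 1`): a binary matrix indexed by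
`𝔽₂ᵐ × 𝔽₂ᵐ` with exactly two nonzero entries in each row and each column. -/
def InM {m : ℕ} (E : BV m × BV m → Fin 2) : Prop :=
  (∀ i, (Finset.univ.filter (fun j => E (i, j) = 1)).card = 2) ∧
  (∀ j, (Finset.univ.filter (fun i => E (i, j) = 1)).card = 2)

/-- The vertical signature: to each row index `i` it assigns the XOR (sum in `𝔽₂ᵐ`)
of the column indices of the nonzero entries in row `i`. -/
def vsig {m : ℕ} (E : BV m × BV m → Fin 2) (i : BV m) : BV m :=
  ∑ j ∈ Finset.univ.filter (fun j => E (i, j) = 1), j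

/-- The horizontal signature: to each column index `j` it assigns the XOR of the
row indices of the nonzero entries in column `j`. -/
def hsig {m : ℕ} (E : BV m × BV m → Fin 2) (j : BV m) : BV m :=
  ∑ i ∈ Finset.univ.filter (fun i => E (i, j) = 1), i

/-- `m_n = |M_n|` (stated with `m = n/2 - 1`). -/
noncomputable def mCount (m : ℕ) : ℕ :=
  Nat.card {E : BV m × BV m → Fin 2 // InM E}

/-- `s_n`, the number of distinct vertical signatures of elements of `M_n`
(stated with `m = n/2 - 1`). -/
noncomputable def sCount (m : ℕ) : ℕ :=
  Set.ncard {σ : BV m → BV m | ∃ E, InM E ∧ vsig E = σ}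

open Finset

/-- Cauchy–Schwarz for the fibres of a map. -/
theorem card_sq_le_card_pairs_mul {α β : Type*} [Fintype α] [Fintype β] [DecidableEq β]
    (g : α → β) :
    Fintype.card α ^ 2 ≤ Fintype.card {p : α × α // g p.1 = g p.2} * Fintype.card β := by
  classical
  have h1 : Fintype.card α = ∑ b : β, Fintype.card {a // g a = b} := by
    rw [← Fintype.card_sigma]
    exact Fintype.card_congr (Equiv.sigmaFiberEquiv g).symm
  have h2 : Fintype.card {p : α × α // g p.1 = g p.2}
      = ∑ b : β, Fintype.card {a // g a = b} ^ 2 := by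
    have : ∀ b : β, Fintype.card {a // g a = b} ^ 2
        = Fintype.card ({a // g a = b} × {a // g a = b}) := fun b => by
      rw [Fintype.card_prod, sq]
    simp_rw [this]
    rw [← Fintype.card_sigma]
    exact Fintype.card_congr
      { toFun := fun p => ⟨g p.1.1, ⟨p.1.1, rfl⟩, ⟨p.1.2, p.2.symm⟩⟩
        invFun := fun q => ⟨(q.2.1.1, q.2.2.1), q.2.1.2.trans q.2.2.2.symm⟩
        left_inv := fun _ => rfl
        right_inv := by rintro ⟨b, ⟨x, rfl⟩, ⟨y, hy⟩⟩; rfl }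
  rw [h1, h2, mul_comm]
  exact sq_sum_le_card_mul_sum_sq

/-- Two applications of Cauchy–Schwarz bound below the number of closed 4-cycles. -/
theorem card_pow_four_le_card_cycles_mul {α β γ : Type*} [Fintype α] [Fintype β] [Fintype γ]
    [DecidableEq β] [DecidableEq γ] (v : α → β) (h : α → γ) :
    Fintype.card α ^ 4 ≤
      Fintype.card {q : {p : α × α // h p.1 = h p.2} × {p : α × α // h p.1 = h p.2} //
        (v q.1.1.1, v q.1.1.2) = (v q.2.1.1, v q.2.1.2)} *
        (Fintype.card β ^ 2 * Fintype.card γ ^ 2) := by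
  have h1 := card_sq_le_card_pairs_mul h
  have h2 := card_sq_le_card_pairs_mul
    (fun p : {p : α × α // h p.1 = h p.2} => (v p.1.1, v p.1.2))
  rw [Fintype.card_prod] at h2
  calc Fintype.card α ^ 4 = (Fintype.card α ^ 2) ^ 2 := by ring
    _ ≤ (Fintype.card {p : α × α // h p.1 = h p.2} * Fintype.card γ) ^ 2 :=
        Nat.pow_le_pow_left h1 2
    _ = Fintype.card {p : α × α // h p.1 = h p.2} ^ 2 * Fintype.card γ ^ 2 := by ring
    _ ≤ _ := by
        refine (Nat.mul_le_mul_right _ h2).trans (le_of_eq ?_)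
        ring

/-- The additive character of `ZMod 2`. -/
def sgn (a : ZMod 2) : ℤ := (-1) ^ a.val

theorem sgn_add (a b : ZMod 2) : sgn (a + b) = sgn a * sgn b := by
  revert a b; decide

theorem sgn_zero : sgn 0 = 1 := by decide

theorem sgn_ne_zero (a : ZMod 2) : sgn a ≠ 0 := by
  revert a; decide

theorem sgn_injective : Function.Injective sgn := by
  unfold Function.Injective; decide

/-- Four signs with product `-1` sum to `±2`. -/
theorem abs_sum_sgn_eq_two {ι : Type*} {P : Finset ι} (hP : P.card = 4) {t : ι → ZMod 2}
    (ht : ∑ u ∈ P, t u = 1) : |∑ u ∈ P, sgn (t u)| = 2 := by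
  classical
  obtain ⟨a, b, c, d, hab, hac, had, hbc, hbd, hcd, rfl⟩ := Finset.card_eq_four.1 hP
  have e : ∀ {M : Type} [AddCommMonoid M] (g : ι → M),
      ∑ u ∈ ({a, b, c, d} : Finset ι), g u = g a + (g b + (g c + g d)) := by
    intro M _ g
    rw [sum_insert (by simp [hab, hac, had]), sum_insert (by simp [hbc, hbd]),
      sum_insert (by simp [hcd]), sum_singleton]
  rw [e] at ht ⊢
  generalize t a = x at *
  generalize t b = y at *
  generalize t c = z at *
  generalize t d = w at *
  revert x y z w
  decide

theorem ip_add_left {n : ℕ} (x y z : BV n) : ip (x + y) z = ip x z + ip y z := by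
  simp [ip, add_mul, sum_add_distrib]

theorem ip_add_right {n : ℕ} (x y z : BV n) : ip x (y + z) = ip x y + ip x z := by
  simp [ip, mul_add, sum_add_distrib]

theorem ip_zero_left {n : ℕ} (x : BV n) : ip 0 x = 0 := by
  simp [ip]

theorem ip_sum_left {n : ℕ} {ι : Type*} (s : Finset ι) (f : ι → BV n) (z : BV n) :
    ip (∑ i ∈ s, f i) z = ∑ i ∈ s, ip (f i) z := by
  classical
  induction s using Finset.induction_on with
  | empty => simp [ip_zero_left]
  | insert a s ha ih => rw [sum_insert ha, sum_insert ha, ip_add_left, ih]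

theorem ip_single_right {n : ℕ} (u : BV n) (i : Fin n) : ip u (Pi.single i 1) = u i := by
  simp [ip, Pi.single_apply]

theorem sum_sgn_ip {n : ℕ} (u : BV n) :
    ∑ x : BV n, sgn (ip u x) = if u = 0 then 2 ^ n else 0 := by
  split_ifs with h
  · subst h
    simp [ip_zero_left, sgn_zero, ZMod.card]
  · obtain ⟨i, hi⟩ := Function.ne_iff.1 h
    have hi1 : u i = 1 := by
      have : ∀ a : ZMod 2, a ≠ 0 → a = 1 := by decide
      exact this _ hi
    have key : ∑ x : BV n, sgn (ip u x) = ∑ x : BV n, sgn (ip u (x + Pi.single i 1)) :=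
      (Equiv.sum_comp (Equiv.addRight (Pi.single i 1 : BV n)) (fun x => sgn (ip u x))).symm
    have h1 : sgn 1 = -1 := by decide
    simp only [ip_add_right, sgn_add, ip_single_right, hi1, h1, mul_neg, mul_one,
      sum_neg_distrib] at key
    linarith

theorem add_eq_zero_iff_eq_bv {n : ℕ} (u a : BV n) : u + a = 0 ↔ u = a := by
  have h2 : ∀ x y : ZMod 2, x + y = 0 ↔ x = y := by decide
  simp only [funext_iff, Pi.add_apply, Pi.zero_apply, h2]

/-- Fourier inversion on `𝔽₂ⁿ`. -/
theorem sum_mul_sum_sgn_ip {n : ℕ} (g : BV n → ℤ) (a : BV n) :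
    ∑ x : BV n, (∑ u, g u * sgn (ip u x)) * sgn (ip a x) = 2 ^ n * g a := by
  have : ∀ x : BV n, (∑ u, g u * sgn (ip u x)) * sgn (ip a x)
      = ∑ u, g u * sgn (ip (u + a) x) := fun x => by
    rw [sum_mul]
    exact sum_congr rfl fun u _ => by rw [ip_add_left, sgn_add]; ring
  simp_rw [this]
  rw [sum_comm]
  simp_rw [← mul_sum, sum_sgn_ip, add_eq_zero_iff_eq_bv]
  simp [mul_comm]

/-- The unnormalized Fourier transforms of all rows and columns of `H` take values `±2`. -/
def IsFlat {k : ℕ} (H : BV k → BV k → ℤ) : Prop :=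
  (∀ y x, |∑ u, H u y * sgn (ip u x)| = 2) ∧ (∀ u y, |∑ w, H u w * sgn (ip w y)| = 2)

/-- The Boolean function whose partial Fourier transform is proportional to `H`. -/
def flatFun {k : ℕ} (H : BV k → BV k → ℤ) (z : BV (k + k)) : ZMod 2 :=
  if ∑ u, H u (fun i => z (Fin.natAdd k i)) * sgn (ip u (fun i => z (Fin.castAdd k i))) = 2
    then 0 else 1

theorem two_mul_sgn_flatFun {k : ℕ} {H : BV k → BV k → ℤ} (hH : IsFlat H) (x y : BV k) :
    2 * sgn (flatFun H (Fin.append x y)) = ∑ u, H u y * sgn (ip u x) := by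
  have h1 : sgn 1 = -1 := by decide
  have := hH.1 y x
  simp only [flatFun, Fin.append_left, Fin.append_right]
  split_ifs with h
  · rw [h, sgn_zero]; rfl
  · rcases (abs_eq (by norm_num)).1 this with h' | h'
    · exact absurd h' h
    · rw [h', h1]; rfl

theorem ip_append {k : ℕ} (x y a b : BV k) :
    ip (Fin.append x y) (Fin.append a b) = ip x a + ip y b := by
  unfold ip
  rw [Fin.sum_univ_add]
  simp only [Fin.append_left, Fin.append_right]

theorem ip_comm {n : ℕ} (x y : BV n) : ip x y = ip y x := by
  simp [ip, mul_comm]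

theorem two_mul_walsh_flatFun {k : ℕ} {H : BV k → BV k → ℤ} (hH : IsFlat H) (a b : BV k) :
    2 * walsh (flatFun H) (Fin.append a b) = 2 ^ k * ∑ w, H a w * sgn (ip w b) := by
  have e : walsh (flatFun H) (Fin.append a b)
      = ∑ p : BV k × BV k, sgn (flatFun H (Fin.append p.1 p.2)
          + ip (Fin.append p.1 p.2) (Fin.append a b)) :=
    (Equiv.sum_comp (Fin.appendEquiv k k)
      (fun z => sgn (flatFun H z + ip z (Fin.append a b)))).symm
  rw [e, Fintype.sum_prod_type_right, mul_sum, mul_sum]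
  refine sum_congr rfl fun w _ => ?_
  rw [← mul_assoc, ← sum_mul_sum_sgn_ip (fun u => H u w) a, mul_sum, sum_mul]
  refine sum_congr rfl fun x _ => ?_
  rw [← two_mul_sgn_flatFun hH, ip_append, sgn_add, sgn_add, ip_comm x a]
  ring

theorem isBent_flatFun {k : ℕ} {H : BV k → BV k → ℤ} (hH : IsFlat H) :
    IsBent (k + k) (flatFun H) := by
  intro z
  obtain ⟨⟨a, b⟩, rfl⟩ := (Fin.appendEquiv k k).surjective z
  have h := congrArg abs (two_mul_walsh_flatFun hH a b)
  rw [abs_mul, abs_mul, hH.2, abs_two, abs_of_nonneg (by positivity : (0 : ℤ) ≤ 2 ^ k)] at h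
  have e : (k + k) / 2 = k := by omega
  rw [e]
  change |walsh (flatFun H) (Fin.append a b)| = 2 ^ k
  linarith

theorem flatFun_injOn {k : ℕ} {H H' : BV k → BV k → ℤ} (hH : IsFlat H) (hH' : IsFlat H')
    (h : flatFun H = flatFun H') : H = H' := by
  funext a y
  have h1 := sum_mul_sum_sgn_ip (fun u => H u y) a
  have h2 := sum_mul_sum_sgn_ip (fun u => H' u y) a
  simp only [← two_mul_sgn_flatFun hH, ← two_mul_sgn_flatFun hH', h] at h1 h2
  have h3 := h1.symm.trans h2
  exact mul_left_cancel₀ (by positivity) h3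

/-- Every row and every column of `P` consists of four vectors with zero sum. -/
structure IsPlanar {k : ℕ} (P : Finset (BV k × BV k)) : Prop where
  row_card : ∀ u, (univ.filter fun w => (u, w) ∈ P).card = 4
  col_card : ∀ w, (univ.filter fun u => (u, w) ∈ P).card = 4
  row_sum : ∀ u, ∑ w ∈ univ.filter (fun w => (u, w) ∈ P), w = 0
  col_sum : ∀ w, ∑ u ∈ univ.filter (fun u => (u, w) ∈ P), u = 0

/-- The row sums and the column sums of a function on `P`. -/
def lineSums {k : ℕ} (P : Finset (BV k × BV k)) :
    (P → ZMod 2) →ₗ[ZMod 2] (BV k → ZMod 2) × (BV k → ZMod 2) where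
  toFun s := (fun u => ∑ w, if h : (u, w) ∈ P then s ⟨(u, w), h⟩ else 0,
    fun w => ∑ u, if h : (u, w) ∈ P then s ⟨(u, w), h⟩ else 0)
  map_add' s t := by
    ext u <;> simp only [Prod.mk_add_mk, Pi.add_apply, ← sum_add_distrib] <;>
      refine sum_congr rfl fun w _ => ?_ <;> split_ifs <;> simp
  map_smul' c s := by
    ext u <;> simp only [Prod.smul_mk, Pi.smul_apply, smul_sum, RingHom.id_apply] <;>
      refine sum_congr rfl fun w _ => ?_ <;> split_ifs <;> simp

/-- A choice of signs on `P` that is odd on every row and column. -/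
abbrev OddSigning {k : ℕ} (P : Finset (BV k × BV k)) : Type :=
  {s : P → ZMod 2 // lineSums P s = (1, 1)}

/-- The signed indicator matrix of `P`. -/
def signedMatrix {k : ℕ} (P : Finset (BV k × BV k)) (s : P → ZMod 2) (u w : BV k) : ℤ :=
  if h : (u, w) ∈ P then sgn (s ⟨(u, w), h⟩) else 0

theorem abs_sum_dite_sgn {k : ℕ} {p : BV k → Prop} [DecidablePred p] (t : ∀ w, p w → ZMod 2)
    (hc : (univ.filter p).card = 4) (hs : ∑ w ∈ univ.filter p, w = 0)
    (ht : ∑ w, (if h : p w then t w h else 0) = 1) (x : BV k) :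
    |∑ w, (if h : p w then sgn (t w h) else 0) * sgn (ip w x)| = 2 := by
  have e : ∑ w, (if h : p w then sgn (t w h) else 0) * sgn (ip w x)
      = ∑ w ∈ univ.filter p, sgn ((if h : p w then t w h else 0) + ip w x) := by
    rw [sum_filter]
    refine sum_congr rfl fun w _ => ?_
    by_cases h : p w <;> simp [h, sgn_add]
  rw [e]
  refine abs_sum_sgn_eq_two hc ?_
  rw [sum_add_distrib, ← ip_sum_left, hs, ip_zero_left, add_zero, sum_filter, ← ht]
  refine sum_congr rfl fun w _ => ?_
  by_cases h : p w <;> simp [h]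

theorem isFlat_signedMatrix {k : ℕ} {P : Finset (BV k × BV k)} (hP : IsPlanar P)
    (s : OddSigning P) : IsFlat (signedMatrix P s.1) := by
  have h := s.2
  rw [Prod.ext_iff] at h
  exact ⟨fun y x => abs_sum_dite_sgn (fun u hu => s.1 ⟨(u, y), hu⟩) (hP.col_card y) (hP.col_sum y)
      (congrFun h.2 y) x,
    fun u y => abs_sum_dite_sgn (fun w hw => s.1 ⟨(u, w), hw⟩) (hP.row_card u) (hP.row_sum u)
      (congrFun h.1 u) y⟩

theorem signedMatrix_injective {k : ℕ} :
    Function.Injective (fun q : Σ P : Finset (BV k × BV k), (P → ZMod 2) =>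
      signedMatrix q.1 q.2) := by
  rintro ⟨P, s⟩ ⟨P', s'⟩ h
  have h' : ∀ u w, signedMatrix P s u w = signedMatrix P' s' u w :=
    fun u w => congrFun (congrFun h u) w
  have hP : P = P' := by
    ext ⟨u, w⟩
    have := h' u w
    unfold signedMatrix at this
    by_cases h1 : (u, w) ∈ P <;> by_cases h2 : (u, w) ∈ P' <;>
      simp [h1, h2, sgn_ne_zero, (sgn_ne_zero _).symm] at this ⊢
  subst hP
  congr
  funext ⟨⟨u, w⟩, hp⟩
  have := h' u w
  simp only [signedMatrix, hp, dite_true] at this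
  exact sgn_injective this

theorem IsPlanar.exists_matching {k : ℕ} {P : Finset (BV k × BV k)} (hP : IsPlanar P) :
    ∃ f : BV k → BV k, Function.Bijective f ∧ ∀ u, (u, f u) ∈ P := by
  classical
  obtain ⟨f, hf, hfP⟩ := (Finset.all_card_le_biUnion_card_iff_exists_injective
    (fun u : BV k => univ.filter fun w => (u, w) ∈ P)).1 (by
      intro s
      have := Finset.card_mul_le_card_mul (fun u w => (u, w) ∈ P) (s := s)
        (t := s.biUnion fun u => univ.filter fun w => (u, w) ∈ P) (m := 4) (n := 4)
        (by
          intro u hu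
          rw [← hP.row_card u]
          refine card_le_card fun w hw => ?_
          simp only [mem_filter, mem_univ, true_and] at hw
          simp only [bipartiteAbove, mem_filter, mem_biUnion, mem_univ, true_and]
          exact ⟨⟨u, hu, hw⟩, hw⟩)
        (by
          intro w _
          rw [← hP.col_card w]
          refine card_le_card fun u hu => ?_
          simp only [bipartiteBelow, mem_filter, mem_univ, true_and] at hu ⊢
          exact hu.2)
      omega)
  exact ⟨f, Finite.injective_iff_bijective.1 hf, fun u => by simpa using hfP u⟩

theorem IsPlanar.exists_oddSigning {k : ℕ} {P : Finset (BV k × BV k)} (hP : IsPlanar P) :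
    ∃ s, lineSums P s = (1, 1) := by
  classical
  obtain ⟨f, hf, hfP⟩ := hP.exists_matching
  refine ⟨fun p => if p.1.2 = f p.1.1 then 1 else 0, Prod.ext (funext fun u => ?_)
    (funext fun w => ?_)⟩
  · change ∑ w, (if h : (u, w) ∈ P then (if w = f u then (1 : ZMod 2) else 0) else 0) = 1
    rw [Fintype.sum_eq_single (f u)]
    · simp [hfP u]
    · intro w hw
      simp [hw]
  · change ∑ u, (if h : (u, w) ∈ P then (if w = f u then (1 : ZMod 2) else 0) else 0) = 1
    obtain ⟨u, rfl⟩ := hf.2 w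
    rw [Fintype.sum_eq_single u]
    · simp [hfP u]
    · intro u' hu'
      simp [hf.1.ne hu'.symm]

theorem IsPlanar.card_eq {k : ℕ} {P : Finset (BV k × BV k)} (hP : IsPlanar P) :
    P.card = 4 * 2 ^ k := by
  classical
  have h1 : P.card = ∑ u : BV k, (univ.filter fun w => (u, w) ∈ P).card := by
    rw [Finset.card_eq_sum_card_fiberwise (f := Prod.fst) (t := univ) (by simp)]
    refine sum_congr rfl fun u _ => ?_
    refine Finset.card_bij' (fun p _ => p.2) (fun w _ => (u, w)) ?_ ?_ ?_ ?_
    · rintro ⟨a, b⟩ h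
      simp only [mem_filter] at h
      obtain ⟨h, rfl⟩ := h
      simpa using h
    · intro w h
      simpa using h
    · rintro ⟨a, b⟩ h
      simp only [mem_filter] at h
      rw [h.2]
    · intro w h
      rfl
  rw [h1]
  simp [hP.row_card, ZMod.card, mul_comm]

theorem IsPlanar.le_card_oddSigning {k : ℕ} (hk : 2 ≤ k) {P : Finset (BV k × BV k)}
    (hP : IsPlanar P) : 32 ≤ Nat.card (OddSigning P) := by
  obtain ⟨s₀, hs₀⟩ := hP.exists_oddSigning
  have e : LinearMap.ker (lineSums P) ≃ OddSigning P :=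
    { toFun := fun t => ⟨t.1 + s₀, by rw [map_add, LinearMap.mem_ker.1 t.2, hs₀, zero_add]⟩
      invFun := fun s => ⟨s.1 - s₀, by rw [LinearMap.mem_ker, map_sub, s.2, hs₀, sub_self]⟩
      left_inv := fun t => by simp
      right_inv := fun s => by simp }
  rw [← Nat.card_congr e, Module.natCard_eq_pow_finrank (K := ZMod 2), Nat.card_zmod]
  have h1 := LinearMap.finrank_range_add_finrank_ker (lineSums P)
  have h2 := Submodule.finrank_le (LinearMap.range (lineSums P))
  have h3 : Module.finrank (ZMod 2) (P → ZMod 2) = 4 * 2 ^ k := by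
    rw [Module.finrank_fintype_fun_eq_card, Fintype.card_coe, hP.card_eq]
  have h4 : Module.finrank (ZMod 2) ((BV k → ZMod 2) × (BV k → ZMod 2)) = 2 * 2 ^ k := by
    rw [Module.finrank_prod, Module.finrank_fintype_fun_eq_card]
    simp [ZMod.card, two_mul]
  have h5 : 2 ^ 2 ≤ 2 ^ k := Nat.pow_le_pow_right (by norm_num) hk
  calc 32 = 2 ^ 5 := by norm_num
    _ ≤ _ := Nat.pow_le_pow_right (by norm_num) (by omega)

theorem card_planar_le_bentCount {k : ℕ} (hk : 2 ≤ k) :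
    32 * Nat.card {P : Finset (BV k × BV k) // IsPlanar P} ≤ bentCount (k + k) := by
  classical
  have h1 : 32 * Nat.card {P : Finset (BV k × BV k) // IsPlanar P} ≤
      Nat.card (Σ P : {P : Finset (BV k × BV k) // IsPlanar P}, OddSigning P.1) := by
    rw [Nat.card_sigma, Nat.card_eq_fintype_card, mul_comm, ← smul_eq_mul, ← Finset.card_univ]
    exact Finset.card_nsmul_le_sum _ _ _ fun P _ => P.2.le_card_oddSigning hk
  refine h1.trans (Nat.card_le_card_of_injective
    (fun q => ⟨flatFun (signedMatrix q.1.1 q.2.1),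
      isBent_flatFun (isFlat_signedMatrix q.1.2 q.2)⟩) ?_)
  rintro ⟨⟨P, hP⟩, s⟩ ⟨⟨P', hP'⟩, s'⟩ h
  have h2 := flatFun_injOn (isFlat_signedMatrix hP s) (isFlat_signedMatrix hP' s')
    (congrArg Subtype.val h)
  have h3 := @signedMatrix_injective k ⟨P, s.1⟩ ⟨P', s'.1⟩ h2
  obtain ⟨rfl, h4⟩ := Sigma.mk.inj_iff.1 h3
  obtain rfl := Subtype.ext (eq_of_heq h4)
  rfl

theorem sum_bv_succ {m : ℕ} {M : Type*} [AddCommMonoid M] (g : BV (m + 1) → M) :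
    ∑ u, g u = ∑ j : BV m, g (Fin.cons 0 j) + ∑ j : BV m, g (Fin.cons 1 j) := by
  rw [← Equiv.sum_comp (Fin.consEquiv fun _ : Fin (m + 1) => ZMod 2) g, Fintype.sum_prod_type]
  exact Fin.sum_univ_two _

/-- A vector set in `𝔽₂ᵐ⁺¹` glued from two pairs with the same sum. -/
theorem card_and_sum_glue {m : ℕ} (p : BV (m + 1) → Prop) [DecidablePred p]
    (p₀ p₁ : BV m → Prop) [DecidablePred p₀] [DecidablePred p₁]
    (h₀ : ∀ j, p (Fin.cons 0 j) ↔ p₀ j) (h₁ : ∀ j, p (Fin.cons 1 j) ↔ p₁ j)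
    (c₀ : (univ.filter p₀).card = 2) (c₁ : (univ.filter p₁).card = 2)
    (hs : ∑ j ∈ univ.filter p₀, j = ∑ j ∈ univ.filter p₁, j) :
    (univ.filter p).card = 4 ∧ ∑ w ∈ univ.filter p, w = 0 := by
  have h2 : ∀ a : ZMod 2, a + a = 0 := by decide
  constructor
  · rw [card_filter] at c₀ c₁ ⊢
    rw [sum_bv_succ]
    simp only [h₀, h₁, c₀, c₁]
  · rw [sum_filter, sum_bv_succ]
    simp only [h₀, h₁]
    rw [← sum_filter, ← sum_filter]
    funext i
    refine Fin.cases ?_ (fun i => ?_) i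
    · simp only [Pi.add_apply, Finset.sum_apply, Fin.cons_zero, Pi.zero_apply, sum_const, c₁]
      rw [smul_zero, zero_add]
      decide
    · have := congrFun hs i
      simp only [Finset.sum_apply] at this
      simp only [Pi.add_apply, Finset.sum_apply, Fin.cons_succ, Pi.zero_apply, this, h2]

/-- The block matrix with the four given blocks, as a subset of `𝔽₂ᵐ⁺¹ × 𝔽₂ᵐ⁺¹`. -/
def blockSet {m : ℕ} (E₀₀ E₁₀ E₀₁ E₁₁ : BV m × BV m → Fin 2) :
    Finset (BV (m + 1) × BV (m + 1)) :=
  univ.filter fun p =>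
    (if p.1 0 = 0 then (if p.2 0 = 0 then E₀₀ else E₀₁) else (if p.2 0 = 0 then E₁₀ else E₁₁))
      (Fin.tail p.1, Fin.tail p.2) = 1

theorem mem_blockSet {m : ℕ} (E₀₀ E₁₀ E₀₁ E₁₁ : BV m × BV m → Fin 2) (i j : BV m) :
    (((Fin.cons 0 i, Fin.cons 0 j) : BV (m + 1) × BV (m + 1)) ∈ blockSet E₀₀ E₁₀ E₀₁ E₁₁ ↔
      E₀₀ (i, j) = 1) ∧
    (((Fin.cons 0 i, Fin.cons 1 j) : BV (m + 1) × BV (m + 1)) ∈ blockSet E₀₀ E₁₀ E₀₁ E₁₁ ↔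
      E₀₁ (i, j) = 1) ∧
    (((Fin.cons 1 i, Fin.cons 0 j) : BV (m + 1) × BV (m + 1)) ∈ blockSet E₀₀ E₁₀ E₀₁ E₁₁ ↔
      E₁₀ (i, j) = 1) ∧
    (((Fin.cons 1 i, Fin.cons 1 j) : BV (m + 1) × BV (m + 1)) ∈ blockSet E₀₀ E₁₀ E₀₁ E₁₁ ↔
      E₁₁ (i, j) = 1) := by
  simp [blockSet]

theorem isPlanar_blockSet {m : ℕ} {E₀₀ E₁₀ E₀₁ E₁₁ : BV m × BV m → Fin 2}
    (h₀₀ : InM E₀₀) (h₁₀ : InM E₁₀) (h₀₁ : InM E₀₁) (h₁₁ : InM E₁₁)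
    (hv₀ : vsig E₀₀ = vsig E₀₁) (hv₁ : vsig E₁₀ = vsig E₁₁)
    (hh₀ : hsig E₀₀ = hsig E₁₀) (hh₁ : hsig E₀₁ = hsig E₁₁) :
    IsPlanar (blockSet E₀₀ E₁₀ E₀₁ E₁₁) := by
  have mem := mem_blockSet E₀₀ E₁₀ E₀₁ E₁₁
  have bit : ∀ a : ZMod 2, a = 0 ∨ a = 1 := by decide
  have row : ∀ u, (univ.filter fun w => (u, w) ∈ blockSet E₀₀ E₁₀ E₀₁ E₁₁).card = 4 ∧
      ∑ w ∈ univ.filter (fun w => (u, w) ∈ blockSet E₀₀ E₁₀ E₀₁ E₁₁), w = 0 := by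
    refine Fin.consCases fun a i => ?_
    rcases bit a with rfl | rfl
    · exact card_and_sum_glue _ _ _ (fun j => (mem i j).1) (fun j => (mem i j).2.1)
        (h₀₀.1 i) (h₀₁.1 i) (congrFun hv₀ i)
    · exact card_and_sum_glue _ _ _ (fun j => (mem i j).2.2.1) (fun j => (mem i j).2.2.2)
        (h₁₀.1 i) (h₁₁.1 i) (congrFun hv₁ i)
  have col : ∀ w, (univ.filter fun u => (u, w) ∈ blockSet E₀₀ E₁₀ E₀₁ E₁₁).card = 4 ∧
      ∑ u ∈ univ.filter (fun u => (u, w) ∈ blockSet E₀₀ E₁₀ E₀₁ E₁₁), u = 0 := by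
    refine Fin.consCases fun a j => ?_
    rcases bit a with rfl | rfl
    · exact card_and_sum_glue _ _ _ (fun i => (mem i j).1) (fun i => (mem i j).2.2.1)
        (h₀₀.2 j) (h₁₀.2 j) (congrFun hh₀ j)
    · exact card_and_sum_glue _ _ _ (fun i => (mem i j).2.1) (fun i => (mem i j).2.2.2)
        (h₀₁.2 j) (h₁₁.2 j) (congrFun hh₁ j)
  exact ⟨fun u => (row u).1, fun w => (col w).1, fun u => (row u).2, fun w => (col w).2⟩

theorem blockSet_injective {m : ℕ} {E₀₀ E₁₀ E₀₁ E₁₁ F₀₀ F₁₀ F₀₁ F₁₁ : BV m × BV m → Fin 2}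
    (h : blockSet E₀₀ E₁₀ E₀₁ E₁₁ = blockSet F₀₀ F₁₀ F₀₁ F₁₁) :
    E₀₀ = F₀₀ ∧ E₁₀ = F₁₀ ∧ E₀₁ = F₀₁ ∧ E₁₁ = F₁₁ := by
  have bit : ∀ a b : Fin 2, (a = 1 ↔ b = 1) → a = b := by decide
  have mem := mem_blockSet E₀₀ E₁₀ E₀₁ E₁₁
  rw [h] at mem
  have mem' := mem_blockSet F₀₀ F₁₀ F₀₁ F₁₁
  refine ⟨?_, ?_, ?_, ?_⟩ <;> funext ⟨i, j⟩ <;> refine bit _ _ ?_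
  · exact (mem i j).1.symm.trans (mem' i j).1
  · exact (mem i j).2.2.1.symm.trans (mem' i j).2.2.1
  · exact (mem i j).2.1.symm.trans (mem' i j).2.1
  · exact (mem i j).2.2.2.symm.trans (mem' i j).2.2.2

theorem ncard_hsig_eq_sCount (m : ℕ) :
    Set.ncard {σ : BV m → BV m | ∃ E, InM E ∧ hsig E = σ} = sCount m := by
  unfold sCount
  congr 1
  ext σ
  constructor
  · rintro ⟨E, hE, rfl⟩
    exact ⟨fun p => E (p.2, p.1), ⟨hE.2, hE.1⟩, rfl⟩
  · rintro ⟨E, hE, rfl⟩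
    exact ⟨fun p => E (p.2, p.1), ⟨hE.2, hE.1⟩, rfl⟩

theorem mCount_pow_four_le (m : ℕ) :
    mCount m ^ 4 ≤
      Nat.card {P : Finset (BV (m + 1) × BV (m + 1)) // IsPlanar P} * sCount m ^ 4 := by
  classical
  let α := {E : BV m × BV m → Fin 2 // InM E}
  let v : α → {σ : BV m → BV m | ∃ E, InM E ∧ vsig E = σ} := fun E => ⟨vsig E.1, E.1, E.2, rfl⟩
  let h : α → {σ : BV m → BV m | ∃ E, InM E ∧ hsig E = σ} := fun E => ⟨hsig E.1, E.1, E.2, rfl⟩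
  have key := card_pow_four_le_card_cycles_mul v h
  simp only [← Nat.card_eq_fintype_card, Nat.card_coe_set_eq, ncard_hsig_eq_sCount] at key
  change mCount m ^ 4 ≤ _ * (sCount m ^ 2 * sCount m ^ 2) at key
  rw [← pow_add] at key
  refine key.trans (Nat.mul_le_mul_right _ ?_)
  have hv : ∀ {E F : α}, v E = v F → vsig E.1 = vsig F.1 := fun e => congrArg Subtype.val e
  have hh : ∀ {E F : α}, h E = h F → hsig E.1 = hsig F.1 := fun e => congrArg Subtype.val e
  refine Nat.card_le_card_of_injective
    (fun q => ⟨blockSet q.1.1.1.1.1 q.1.1.1.2.1 q.1.2.1.1.1 q.1.2.1.2.1,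
      isPlanar_blockSet q.1.1.1.1.2 q.1.1.1.2.2 q.1.2.1.1.2 q.1.2.1.2.2
        (hv (Prod.ext_iff.1 q.2).1) (hv (Prod.ext_iff.1 q.2).2) (hh q.1.1.2) (hh q.1.2.2)⟩) ?_
  rintro ⟨⟨⟨⟨A, B⟩, _⟩, ⟨⟨C, D⟩, _⟩⟩, _⟩ ⟨⟨⟨⟨A', B'⟩, _⟩, ⟨⟨C', D'⟩, _⟩⟩, _⟩ e
  obtain ⟨a, b, c, d⟩ := blockSet_injective (congrArg Subtype.val e)
  obtain rfl := Subtype.ext a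
  obtain rfl := Subtype.ext b
  obtain rfl := Subtype.ext c
  obtain rfl := Subtype.ext d
  rfl

/-- for every even `n ≥ 4`, `b_n ≥ 32·m_n⁴/s_n⁴`, stated as
`b_n · s_n⁴ ≥ 32 · m_n⁴`. -/
theorem stmt_3 (n : ℕ) (hn : Even n) (h4 : 4 ≤ n) :
    32 * mCount (n / 2 - 1) ^ 4 ≤ bentCount n * sCount (n / 2 - 1) ^ 4 := by
  obtain ⟨k, rfl⟩ := hn
  obtain ⟨m, rfl⟩ : ∃ m, k = m + 1 := ⟨k - 1, by omega⟩
  have e : (m + 1 + (m + 1)) / 2 - 1 = m := by omega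
  rw [e]
  calc 32 * mCount m ^ 4
      ≤ 32 * (Nat.card {P : Finset (BV (m + 1) × BV (m + 1)) // IsPlanar P} * sCount m ^ 4) :=
        Nat.mul_le_mul_left _ (mCount_pow_four_le m)
    _ = 32 * Nat.card {P : Finset (BV (m + 1) × BV (m + 1)) // IsPlanar P} * sCount m ^ 4 := by
        ring
    _ ≤ _ := Nat.mul_le_mul_right _ (card_planar_le_bentCount (by omega))
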